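/- Under the stated assumptions, for every compact set K ⊆ ℝ, sup_{c ∈ K} |Ĝ_N(c) − G(c)| → 0 in probability as N → ∞. That is, the empirical distribution of the heteroskedasticity-rescaled residuals of the control units converges uniformly on compacts, in probability, to the common cdf G of the standardized errors, even under cross-sectional dependence. -/

import Mathlib

open MeasureTheory ProbabilityTheory Filter

/-- If the distances of two random elements to fixed points tend to zero in measure, so does the
distance of the pair. -/
lemma tendsto_measure_le_dist_prodMk {Ω ι E F : Type*} [MeasurableSpace Ω] {μ : Measure Ω}
    [PseudoMetricSpace E] [PseudoMetricSpace F] {l : Filter ι}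
    {f : ι → Ω → E} {g : ι → Ω → F} {x₀ : E} {y₀ : F}
    (hf : ∀ ε, 0 < ε → Tendsto (fun i => μ {ω | ε ≤ dist (f i ω) x₀}) l (nhds 0))
    (hg : ∀ ε, 0 < ε → Tendsto (fun i => μ {ω | ε ≤ dist (g i ω) y₀}) l (nhds 0)) :
    ∀ ε, 0 < ε → Tendsto (fun i => μ {ω | ε ≤ dist (f i ω, g i ω) (x₀, y₀)}) l (nhds 0) := by
  intro ε hε
  have hsum := (hf ε hε).add (hg ε hε)
  rw [add_zero] at hsum
  refine tendsto_of_tendsto_of_tendsto_of_le_of_le tendsto_const_nhds hsum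
    (fun _ => zero_le) (fun i => ?_)
  refine (measure_mono fun ω hω => ?_).trans (measure_union_le _ _)
  simpa [Prod.dist_eq, le_max_iff] using hω

/-- The values of a bounded nonnegative function on a set are at most its supremum over the
set. -/
lemma le_biSup_of_nonneg_of_le {α : Type*} {s : Set α} {f : α → ℝ} {B : ℝ}
    (hf : ∀ x, 0 ≤ f x) (hB : ∀ x, f x ≤ B) {x : α} (hx : x ∈ s) :
    f x ≤ ⨆ y ∈ s, f y := by
  have hbdd : BddAbove (Set.range fun y => ⨆ _ : y ∈ s, f y) := by
    refine ⟨B, ?_⟩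
    rintro _ ⟨y, rfl⟩
    exact Real.iSup_le (fun _ => hB y) ((hf y).trans (hB y))
  refine le_ciSup_of_le hbdd x ?_
  simp [hx]

/-- If random functions `F N` converge to a continuous function `φ` in probability, uniformly on
compacts, then plugging in a parameter converging in probability to `a₀` gives convergence to
`φ (·, a₀)` in probability, uniformly on compacts. -/
lemma tendstoInMeasure_biSup_plugin {Ω C A : Type*} [MeasurableSpace Ω] {μ : Measure Ω}
    [TopologicalSpace C] [PseudoMetricSpace A] [ProperSpace A]
    {F : ℕ → Ω → C × A → ℝ} {φ : C × A → ℝ} {B : ℝ}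
    (hφ : Continuous φ) (hB : ∀ N ω x, |F N ω x - φ x| ≤ B)
    {K : Set C} (hK : IsCompact K)
    (hF : ∀ Θ : Set A, IsCompact Θ →
      TendstoInMeasure μ (fun N ω => ⨆ x ∈ K ×ˢ Θ, |F N ω x - φ x|) atTop (fun _ => (0 : ℝ)))
    {a : ℕ → Ω → A} {a₀ : A}
    (ha : ∀ r, 0 < r → Tendsto (fun N => μ {ω | r ≤ dist (a N ω) a₀}) atTop (nhds 0)) :
    TendstoInMeasure μ (fun N ω => ⨆ c ∈ K, |F N ω (c, a N ω) - φ (c, a₀)|)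
      atTop (fun _ => (0 : ℝ)) := by
  rw [tendstoInMeasure_iff_dist]
  intro ε hε
  obtain ⟨v, hv, hvφ⟩ := hK.mem_uniformity_of_prod (f := fun b c => φ (c, b)) (s := Set.univ)
    (q := a₀) (by unfold Function.uncurry; fun_prop) (Set.mem_univ _)
    (Metric.dist_mem_uniformity (show 0 < ε / 4 by positivity))
  rw [nhdsWithin_univ] at hv
  obtain ⟨r, hr, hrv⟩ := Metric.mem_nhds_iff.mp hv
  have hsup := hF _ (isCompact_closedBall a₀ r)
  rw [tendstoInMeasure_iff_dist] at hsup
  have hsum := (hsup (ε / 2) (by positivity)).add (ha r hr)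
  rw [add_zero] at hsum
  refine tendsto_of_tendsto_of_tendsto_of_le_of_le tendsto_const_nhds hsum
    (fun _ => zero_le) (fun N => ?_)
  refine (measure_mono fun ω hω => ?_).trans (measure_union_le _ _)
  by_contra hcon
  simp only [Set.mem_union, Set.mem_ofPred_eq, not_or, not_le, Real.dist_0_eq_abs] at hcon hω
  obtain ⟨hsupω, haω⟩ := hcon
  have hbound : ⨆ c ∈ K, |F N ω (c, a N ω) - φ (c, a₀)| ≤ 3 * ε / 4 := by
    refine Real.iSup_le (fun c => Real.iSup_le (fun hc => ?_) (by positivity)) (by positivity)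
    have hFφ := le_biSup_of_nonneg_of_le (s := K ×ˢ Metric.closedBall a₀ r)
      (f := fun x => |F N ω x - φ x|) (x := (c, a N ω)) (fun _ => abs_nonneg _) (hB N ω)
      ⟨hc, haω.le⟩
    have hφφ : |φ (c, a N ω) - φ (c, a₀)| < ε / 4 := hvφ _ (hrv haω) c hc
    have htri := abs_sub_le (F N ω (c, a N ω)) (φ (c, a N ω)) (φ (c, a₀))
    have hself := le_abs_self (⨆ x ∈ K ×ˢ Metric.closedBall a₀ r, |F N ω x - φ x|)
    linarith
  have hnonneg : 0 ≤ ⨆ c ∈ K, |F N ω (c, a N ω) - φ (c, a₀)| :=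
    Real.iSup_nonneg fun c => Real.iSup_nonneg fun _ => abs_nonneg _
  rw [abs_of_nonneg hnonneg] at hω
  linarith

/-- An empirical frequency lies in the unit interval. -/
lemma inv_mul_sum_indicator_mem_Icc (N : ℕ) (P : ℕ → Prop) [DecidablePred P] :
    (N : ℝ)⁻¹ * ∑ i ∈ Finset.range N, (if P i then (1 : ℝ) else 0) ∈ Set.Icc (0 : ℝ) 1 := by
  have hle : ∑ i ∈ Finset.range N, (if P i then (1 : ℝ) else 0) ≤ N := by
    simpa using Finset.sum_le_sum (s := Finset.range N) (g := fun _ => (1 : ℝ))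
      (fun i _ => show (if P i then (1 : ℝ) else 0) ≤ 1 by split_ifs <;> norm_num)
  refine ⟨mul_nonneg (by positivity) (Finset.sum_nonneg fun i _ => by positivity), ?_⟩
  exact inv_mul_le_one_of_le₀ hle (Nat.cast_nonneg N)

/-- Proposition 3 (Ferman 2021): under heteroskedasticity of known form, the empirical
distribution of the rescaled residuals of the control units converges uniformly on
compacts, in probability, to the common cdf `G` of the standardized errors, even under
cross-sectional dependence. -/
theorem rescaled_residual_edf_uniform_convergence
    {Ω : Type*} [MeasureSpace Ω] [IsProbabilityMeasure (ℙ : Measure Ω)]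
    (p q m : ℕ) (hp : 1 ≤ p) (hq : 1 ≤ q) (hm : 1 ≤ m)
    (ν : Measure ℝ) [IsProbabilityMeasure ν]
    (G : ℝ → ℝ) (hG : ∀ c, G c = (ν (Set.Iic c)).toReal)
    (hGcont : Continuous G)
    (hmom2 : ∫⁻ x, ENNReal.ofReal (x ^ 2) ∂ν < ⊤)
    -- heteroskedasticity function, continuous and strictly positive
    (h : (Fin q → ℝ) → (Fin m → ℝ) → ℝ)
    (hhcont : Continuous (fun zd : (Fin q → ℝ) × (Fin m → ℝ) => h zd.1 zd.2))
    (hhpos : ∀ z d, 0 < h z d)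
    -- true parameters
    (δ : Fin m → ℝ) (β : Fin p → ℝ) (xbar₀ : Fin p → ℝ)
    -- data: identically jointly distributed triples, ξᵢ with law ν
    (Z : ℕ → Ω → (Fin q → ℝ)) (X : ℕ → Ω → (Fin p → ℝ)) (ξ : ℕ → Ω → ℝ)
    (hlaw : ∀ i, Measure.map (fun ω => (Z i ω, X i ω, ξ i ω)) ℙ
      = Measure.map (fun ω => (Z 0 ω, X 0 ω, ξ 0 ω)) ℙ)
    (hξ : ∀ i, Measure.map (ξ i) ℙ = ν)
    -- errors W_i = h(Z_i, δ) ξ_i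
    (W : ℕ → Ω → ℝ) (hWdef : ∀ i ω, W i ω = h (Z i ω) δ * ξ i ω)
    -- consistent estimator sequences
    (δhat : ℕ → Ω → (Fin m → ℝ)) (βhat : ℕ → Ω → (Fin p → ℝ))
    (vhat : ℕ → Ω → ℝ) (Xbar : ℕ → Ω → (Fin p → ℝ))
    (hδhat : TendstoInMeasure ℙ δhat atTop (fun _ => δ))
    (hβhat : TendstoInMeasure ℙ βhat atTop (fun _ => β))
    (hvhat : TendstoInMeasure ℙ vhat atTop (fun _ => (0 : ℝ)))
    (hXbar : TendstoInMeasure ℙ Xbar atTop (fun _ => xbar₀))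
    -- rescaled residuals and their empirical distribution function
    (ξhat : ℕ → ℕ → Ω → ℝ)
    (hξhat : ∀ i N ω, ξhat i N ω = (h (Z i ω) (δhat N ω))⁻¹
      * (W i ω + vhat N ω + ∑ j, (X i ω j - Xbar N ω j) * (β j - βhat N ω j)))
    (Ghat : ℕ → Ω → ℝ → ℝ)
    (hGhat : ∀ N ω c, Ghat N ω c
      = (N : ℝ)⁻¹ * ∑ i ∈ Finset.range N, (if ξhat i N ω ≤ c then (1 : ℝ) else 0))
    -- the population function φ, jointly continuous, with φ(c; δ, 0, x̄₀, β) = G(c)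
    (φ : ℝ × (Fin m → ℝ) × ℝ × (Fin p → ℝ) × (Fin p → ℝ) → ℝ)
    (hφdef : ∀ (c : ℝ) (a₁ : Fin m → ℝ) (a₂ : ℝ) (a₃ a₄ : Fin p → ℝ),
      φ (c, a₁, a₂, a₃, a₄)
        = (ℙ {ω | (h (Z 0 ω) a₁)⁻¹
            * (W 0 ω + a₂ + ∑ j, (X 0 ω j - a₃ j) * (β j - a₄ j)) ≤ c}).toReal)
    (hφcont : Continuous φ)
    (hφG : ∀ c : ℝ, φ (c, δ, 0, xbar₀, β) = G c)
    -- uniform law of large numbers over compact parameter sets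
    (hULLN : ∀ (K : Set ℝ) (Θ : Set ((Fin m → ℝ) × ℝ × (Fin p → ℝ) × (Fin p → ℝ))),
      IsCompact K → IsCompact Θ →
      TendstoInMeasure ℙ
        (fun (N : ℕ) (ω : Ω) => ⨆ x ∈ K ×ˢ Θ,
          |(N : ℝ)⁻¹ * (∑ i ∈ Finset.range N,
              (if (h (Z i ω) x.2.1)⁻¹ * (W i ω + x.2.2.1
                  + ∑ j, (X i ω j - x.2.2.2.1 j) * (β j - x.2.2.2.2 j)) ≤ x.1
                then (1 : ℝ) else 0))
            - φ x|)
        atTop (fun _ => (0 : ℝ))) :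
    ∀ K : Set ℝ, IsCompact K →
      TendstoInMeasure ℙ (fun (N : ℕ) (ω : Ω) => ⨆ c ∈ K, |Ghat N ω c - G c|)
        atTop (fun _ => (0 : ℝ)) := by
  intro K hK
  have hahat := tendsto_measure_le_dist_prodMk (tendstoInMeasure_iff_dist.mp hδhat)
    (tendsto_measure_le_dist_prodMk (tendstoInMeasure_iff_dist.mp hvhat)
      (tendsto_measure_le_dist_prodMk (tendstoInMeasure_iff_dist.mp hXbar)
        (tendstoInMeasure_iff_dist.mp hβhat)))
  set F : ℕ → Ω → ℝ × (Fin m → ℝ) × ℝ × (Fin p → ℝ) × (Fin p → ℝ) → ℝ :=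
    fun N ω x => (N : ℝ)⁻¹ * (∑ i ∈ Finset.range N,
      (if (h (Z i ω) x.2.1)⁻¹ * (W i ω + x.2.2.1
          + ∑ j, (X i ω j - x.2.2.2.1 j) * (β j - x.2.2.2.2 j)) ≤ x.1
        then (1 : ℝ) else 0)) with hFdef
  have hFconv : ∀ Θ : Set ((Fin m → ℝ) × ℝ × (Fin p → ℝ) × (Fin p → ℝ)), IsCompact Θ →
      TendstoInMeasure ℙ (fun N ω => ⨆ x ∈ K ×ˢ Θ, |F N ω x - φ x|) atTop
        (fun _ => (0 : ℝ)) :=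
    fun Θ hΘ => hULLN K Θ hK hΘ
  have hFbdd : ∀ N ω x, |F N ω x - φ x| ≤ 1 := by
    rintro N ω ⟨c, a₁, a₂, a₃, a₄⟩
    have hF : F N ω (c, a₁, a₂, a₃, a₄) ∈ Set.Icc (0 : ℝ) 1 :=
      inv_mul_sum_indicator_mem_Icc N _
    have hφ0 : 0 ≤ φ (c, a₁, a₂, a₃, a₄) := by
      rw [hφdef]
      exact ENNReal.toReal_nonneg
    have hφ1 : φ (c, a₁, a₂, a₃, a₄) ≤ 1 := by
      rw [hφdef]
      exact measureReal_le_one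
    rw [abs_le]
    exact ⟨by linarith [hF.1], by linarith [hF.2]⟩
  have hGF : ∀ N ω c, |Ghat N ω c - G c|
      = |F N ω (c, δhat N ω, vhat N ω, Xbar N ω, βhat N ω) - φ (c, δ, 0, xbar₀, β)| := by
    intro N ω c
    simp only [hFdef, hφG, hGhat, hξhat]
  simp only [hGF]
  exact tendstoInMeasure_biSup_plugin hφcont hFbdd hK hFconv hahat
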